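/- Let (X, {e_i^c}, {ε_J}, {ε*_J}) be an A_n epsilon system (total-function model). For every interval [s,t] with t ≤ n−1, every x ∈ X with ε_{t+1}(x) ≠ 0, and every c ∈ ℂˣ: ε_{[s,t]}(e_{t+1}^c x) = ε_{[s,t]}(x) + (c−1) ε_{[s,t+1]}(x)/ε_{t+1}(x), and ε*_{[s,t]}(e_{t+1}^c x) = c·ε*_{[s,t]}(x) + (1−c) ε*_{[s,t+1]}(x)/ε_{t+1}(x). -/

import Mathlib

open Finset

namespace EpsSys

/-- All partitions of the interval `[s,t]` into consecutive blocks `(a,b)` (meaning `{a,…,b}`),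
listed left to right; the first argument is fuel. For the empty interval (`t < s`) the only
partition is the empty list. -/
def partitionsAux : ℕ → ℕ → ℕ → List (List (ℕ × ℕ))
  | 0, _, _ => [[]]
  | fuel+1, s, t =>
    if t < s then [[]]
    else (List.range (t + 1 - s)).flatMap fun d =>
      (partitionsAux fuel (s + d + 1) t).map (fun P => (s, s + d) :: P)

/-- The list of all partitions of the interval `[s,t]`. -/
def partitions (s t : ℕ) : List (List (ℕ × ℕ)) :=
  partitionsAux (t + 1 - s) s t

variable {A : Type*} [CommRing A]

/-- `ε_P`: the product of `ε` over the blocks of a partition `P`. -/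
def epsP (eps : ℕ → ℕ → A) (P : List (ℕ × ℕ)) : A :=
  (P.map fun p => eps p.1 p.2).prod

/-- The partition sum `ε*_{[s,t]} = Σ_{P partition of [s,t]} (−1)^{|J| − l(P)} ε_P`.
For the empty interval (`t < s`) this equals `1`. -/
def epsStar (eps : ℕ → ℕ → A) (s t : ℕ) : A :=
  ((partitions s t).map fun P => (-1 : A) ^ (t + 1 - s - P.length) * epsP eps P).sum

/-- Extension of a family indexed by intervals by the convention `ε_∅ = 1`. -/
def epsE (eps : ℕ → ℕ → A) (s t : ℕ) : A :=
  if t < s then 1 else eps s t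

end EpsSys


namespace EpsSys

/-- An `A_n` epsilon system on a set `X` (total-function model): maps `e_i^c : X → X`
(`act i c`) for `i ∈ {1,…,n}`, `c ∈ ℂˣ`, together with functions `ε_J = eps s t` and
`ε*_J = star s t` for every interval `J = [s,t]` (`1 ≤ s ≤ t ≤ n`), satisfying
`ε*_{[i,i]} = ε_{[i,i]}` and the axioms (E1), (E2), (E3). -/
structure EpsSystem (n : ℕ) (X : Type*) where
  /-- the action `e_i^c` -/
  act : ℕ → ℂˣ → X → X
  /-- `ε_{[s,t]}` -/
  eps : ℕ → ℕ → X → ℂ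
  /-- `ε*_{[s,t]}` -/
  star : ℕ → ℕ → X → ℂ
  /-- `ε*_{[i,i]} = ε_{[i,i]}` -/
  star_diag : ∀ i x, 1 ≤ i → i ≤ n → star i i x = eps i i x
  /-- (E1), first half: `ε_J(e_s^c x) = c⁻¹ ε_J(x)` -/
  eps_act_eq : ∀ s t i (c : ℂˣ) x, 1 ≤ s → s ≤ t → t ≤ n → i = s →
    eps s t (act i c x) = (c : ℂ)⁻¹ * eps s t x
  /-- (E1), second half: `ε_J(e_i^c x) = ε_J(x)` for `i ∉ {s−1, s, t+1}` -/
  eps_act_inv : ∀ s t i (c : ℂˣ) x, 1 ≤ s → s ≤ t → t ≤ n → 1 ≤ i → i ≤ n →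
    i ≠ s - 1 → i ≠ s → i ≠ t + 1 →
    eps s t (act i c x) = eps s t x
  /-- (E2), first half: `ε*_J(e_t^c x) = c⁻¹ ε*_J(x)` -/
  star_act_eq : ∀ s t i (c : ℂˣ) x, 1 ≤ s → s ≤ t → t ≤ n → i = t →
    star s t (act i c x) = (c : ℂ)⁻¹ * star s t x
  /-- (E2), second half: `ε*_J(e_i^c x) = ε*_J(x)` for `i ∉ {s−1, t, t+1}` -/
  star_act_inv : ∀ s t i (c : ℂˣ) x, 1 ≤ s → s ≤ t → t ≤ n → 1 ≤ i → i ≤ n →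
    i ≠ s - 1 → i ≠ t → i ≠ t + 1 →
    star s t (act i c x) = star s t x
  /-- (E3): `ε*_J = Σ_{P partition of J} (−1)^{|J|−l(P)} ε_P` -/
  star_partition : ∀ s t x, 1 ≤ s → s ≤ t → t ≤ n →
    star s t x = EpsSys.epsStar (fun a b => eps a b x) s t

end EpsSys

open EpsSys

namespace EpsSys

theorem partitionsAux_eq_of_le {f g s t : ℕ} (hf : t + 1 - s ≤ f) (hg : t + 1 - s ≤ g) :
    partitionsAux f s t = partitionsAux g s t := by
  induction f generalizing g s with
  | zero =>
    have h : t < s := by omega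
    cases g <;> simp [partitionsAux, h]
  | succ f ih =>
    by_cases h : t < s
    · cases g <;> simp [partitionsAux, h]
    · obtain ⟨g, rfl⟩ : ∃ k, g = k + 1 := ⟨g - 1, by omega⟩
      simp only [partitionsAux, h, if_false]
      congr 1
      funext d
      rw [ih (g := g) (by omega) (by omega)]

theorem length_le_of_mem_partitionsAux {f s t : ℕ} {P : List (ℕ × ℕ)}
    (hP : P ∈ partitionsAux f s t) : P.length ≤ t + 1 - s := by
  induction f generalizing s P with
  | zero => simp_all [partitionsAux]
  | succ f ih =>
    by_cases h : t < s
    · simp_all [partitionsAux]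
    · simp only [partitionsAux, h, if_false, List.mem_flatMap, List.mem_range,
        List.mem_map] at hP
      obtain ⟨d, hd, Q, hQ, rfl⟩ := hP
      have := ih hQ
      simp only [List.length_cons]
      omega

theorem partitions_of_le {s t : ℕ} (h : s ≤ t) :
    partitions s t = (List.range (t + 1 - s)).flatMap fun d =>
      (partitions (s + d + 1) t).map (fun P => (s, s + d) :: P) := by
  obtain ⟨k, hk⟩ : ∃ k, t + 1 - s = k + 1 := ⟨t - s, by omega⟩
  rw [partitions, hk]
  simp only [partitionsAux, not_lt.mpr h, if_false, hk]
  congr 1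
  funext d
  rw [partitions, partitionsAux_eq_of_le (g := t + 1 - (s + d + 1)) (by omega) le_rfl]

theorem epsStar_of_lt {A : Type*} [CommRing A] (eps : ℕ → ℕ → A) {s t : ℕ} (h : t < s) :
    epsStar eps s t = 1 := by
  have h' : t + 1 - s = 0 := by omega
  simp [epsStar, partitions, h', partitionsAux, epsP]

/-- Expansion of `ε*` along the first block of a partition. -/
theorem epsStar_eq_sum {A : Type*} [CommRing A] (eps : ℕ → ℕ → A) {s t : ℕ} (h : s ≤ t) :
    epsStar eps s t =
      ∑ d ∈ range (t + 1 - s), (-1) ^ d * eps s (s + d) * epsStar eps (s + d + 1) t := by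
  rw [epsStar, partitions_of_le h, List.map_flatMap, List.flatMap_def, List.sum_flatten,
    List.map_map, ← List.sum_toFinset _
    List.nodup_range, List.toFinset_range]
  refine sum_congr rfl fun d hd => ?_
  rw [mem_range] at hd
  rw [epsStar, ← List.sum_map_mul_left, Function.comp_apply, List.map_map]
  refine congrArg List.sum (List.map_congr_left fun P hP => ?_)
  have hl := length_le_of_mem_partitionsAux hP
  have he : t + 1 - s - (P.length + 1) = d + (t + 1 - (s + d + 1) - P.length) := by omega
  simp only [Function.comp_apply, epsP, List.map_cons, List.prod_cons, List.length_cons, he,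
    pow_add]
  ring

namespace EpsSystem

variable {n : ℕ} {X : Type*} (S : EpsSystem n X)

theorem star_eq_sum {s k : ℕ} (hs : 1 ≤ s) (hk : s + k ≤ n) (x : X) :
    S.star s (s + k) x =
      ∑ d ∈ range k, (-1) ^ d * S.eps s (s + d) x * S.star (s + d + 1) (s + k) x
        + (-1) ^ k * S.eps s (s + k) x := by
  rw [S.star_partition s (s + k) x hs (by omega) hk, epsStar_eq_sum _ (by omega),
    show s + k + 1 - s = k + 1 by omega, sum_range_succ, epsStar_of_lt _ (by omega), mul_one]
  congr 1
  refine sum_congr rfl fun d hd => ?_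
  rw [mem_range] at hd
  rw [S.star_partition (s + d + 1) (s + k) x (by omega) (by omega) hk]

theorem star_succ_eq_sum {s k : ℕ} (hs : 1 ≤ s) (hk : s + k + 1 ≤ n) (x : X) :
    S.star s (s + k + 1) x =
      ∑ d ∈ range k, (-1) ^ d * S.eps s (s + d) x * S.star (s + d + 1) (s + k + 1) x
        + (-1) ^ k * (S.eps s (s + k) x * S.eps (s + k + 1) (s + k + 1) x
          - S.eps s (s + k + 1) x) := by
  have h := S.star_eq_sum (k := k + 1) hs hk x
  rw [sum_range_succ, ← add_assoc s k 1, S.star_diag _ x (by omega) hk] at h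
  rw [h]
  ring

theorem eps_act_succ {s k : ℕ} (hs : 1 ≤ s) (hk : s + k + 1 ≤ n) (x : X)
    (hx : S.eps (s + k + 1) (s + k + 1) x ≠ 0) (c : ℂˣ) :
    S.eps s (s + k) (S.act (s + k + 1) c x) = S.eps s (s + k) x
      + ((c : ℂ) - 1) * S.eps s (s + k + 1) x / S.eps (s + k + 1) (s + k + 1) x := by
  have hc : (c : ℂ) ≠ 0 := c.ne_zero
  have h := S.star_succ_eq_sum hs hk x
  have h' := S.star_succ_eq_sum hs hk (S.act (s + k + 1) c x)
  have hsum : ∑ d ∈ range k, (-1) ^ d * S.eps s (s + d) (S.act (s + k + 1) c x)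
        * S.star (s + d + 1) (s + k + 1) (S.act (s + k + 1) c x)
      = (c : ℂ)⁻¹ * ∑ d ∈ range k,
        (-1) ^ d * S.eps s (s + d) x * S.star (s + d + 1) (s + k + 1) x := by
    rw [mul_sum]
    refine sum_congr rfl fun d hd => ?_
    rw [mem_range] at hd
    rw [S.eps_act_inv s (s + d) _ c x (by omega) (by omega) (by omega) (by omega) (by omega)
      (by omega) (by omega) (by omega),
      S.star_act_eq _ _ _ c x (by omega) (by omega) (by omega) rfl]
    ring
  rw [hsum, S.star_act_eq _ _ _ c x (by omega) (by omega) (by omega) rfl,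
    S.eps_act_eq (s + k + 1) _ _ c x (by omega) (by omega) (by omega) rfl,
    S.eps_act_inv s (s + k + 1) _ c x (by omega) (by omega) (by omega) (by omega) (by omega)
      (by omega) (by omega) (by omega), h] at h'
  have hpow : (-1 : ℂ) ^ k ≠ 0 := pow_ne_zero _ (by norm_num)
  rw [← sub_eq_iff_eq_add', eq_div_iff hx]
  apply mul_left_cancel₀ hpow
  field_simp at h'
  linear_combination -h'

theorem star_act_succ {s k : ℕ} (hs : 1 ≤ s) (hk : s + k + 1 ≤ n) (x : X)
    (hx : S.eps (s + k + 1) (s + k + 1) x ≠ 0) (c : ℂˣ) :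
    S.star s (s + k) (S.act (s + k + 1) c x) = (c : ℂ) * S.star s (s + k) x
      + (1 - (c : ℂ)) * S.star s (s + k + 1) x / S.eps (s + k + 1) (s + k + 1) x := by
  induction k using Nat.strong_induction_on generalizing s with
  | _ k ih =>
    have hsum : ∑ d ∈ range k, (-1) ^ d * S.eps s (s + d) (S.act (s + k + 1) c x)
          * S.star (s + d + 1) (s + k) (S.act (s + k + 1) c x)
        = (c : ℂ) * ∑ d ∈ range k,
            (-1) ^ d * S.eps s (s + d) x * S.star (s + d + 1) (s + k) x
          + (1 - (c : ℂ)) / S.eps (s + k + 1) (s + k + 1) x * ∑ d ∈ range k,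
            (-1) ^ d * S.eps s (s + d) x * S.star (s + d + 1) (s + k + 1) x := by
      rw [mul_sum, mul_sum, ← sum_add_distrib]
      refine sum_congr rfl fun d hd => ?_
      rw [mem_range] at hd
      have he : s + d + 1 + (k - d - 1) = s + k := by omega
      have hi := ih (k - d - 1) (by omega) (s := s + d + 1) (by omega) (by omega)
      rw [he] at hi
      rw [S.eps_act_inv s (s + d) _ c x (by omega) (by omega) (by omega) (by omega) (by omega)
        (by omega) (by omega) (by omega), hi hx]
      ring
    rw [S.star_eq_sum hs (by omega) (S.act (s + k + 1) c x), hsum, S.eps_act_succ hs hk x hx,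
      S.star_eq_sum hs (by omega) x, S.star_succ_eq_sum hs hk x]
    field_simp
    ring

end EpsSystem

end EpsSys

/-- in an `A_n` epsilon system, for every interval `[s,t]` with `t ≤ n−1`
(i.e. `t+1 ≤ n`), every `x` with `ε_{t+1}(x) ≠ 0` and every `c ∈ ℂˣ`:
`ε_{[s,t]}(e_{t+1}^c x) = ε_{[s,t]}(x) + (c−1) ε_{[s,t+1]}(x)/ε_{t+1}(x)` and
`ε*_{[s,t]}(e_{t+1}^c x) = c·ε*_{[s,t]}(x) + (1−c) ε*_{[s,t+1]}(x)/ε_{t+1}(x)`. -/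
theorem stmt2 (n : ℕ) (hn : 1 ≤ n) {X : Type*} (S : EpsSystem n X)
    (s t : ℕ) (hs : 1 ≤ s) (hst : s ≤ t) (ht : t + 1 ≤ n)
    (x : X) (hx : S.eps (t + 1) (t + 1) x ≠ 0) (c : ℂˣ) :
    S.eps s t (S.act (t + 1) c x)
      = S.eps s t x + ((c : ℂ) - 1) * S.eps s (t + 1) x / S.eps (t + 1) (t + 1) x ∧
    S.star s t (S.act (t + 1) c x)
      = (c : ℂ) * S.star s t x + (1 - (c : ℂ)) * S.star s (t + 1) x / S.eps (t + 1) (t + 1) x := by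
  obtain ⟨k, rfl⟩ := Nat.exists_eq_add_of_le hst
  exact ⟨S.eps_act_succ hs ht x hx c, S.star_act_succ hs ht x hx c⟩
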